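/- arXiv:1504.03175 — 2 statements merged into one kernel-verified Lean document; each statement's English description precedes it below -/
import Mathlib

section
/- Let s ≥ 1, let f ∈ L¹([0,1)^s), and let k ∈ ℕ₀^s with k_i = ∑_{j=1}^{N_i} 2^{a_{i,j}}, a_{i,1} > ⋯ > a_{i,N_i} ≥ 0. Then for any index i with k_i ≠ 0 and any 1 ≤ j ≤ N_i, the function ∂_{i,a_{i,j}+1}(f) is in L¹([0,1)^s) and f̂(k) = (−1) · 2^{−a_{i,j}−2} · (∂_{i,a_{i,j}+1}(f))^̂(k). -/
open MeasureTheory Finset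
open scoped ENNReal

noncomputable section

/-- The `j`-th binary digit (`j ≥ 1`) of a real number `x ∈ [0,1)`
(using the binary expansion in which infinitely many digits are `0`). -/
def bdigit (x : ℝ) (j : ℕ) : ℕ := ⌊x * 2 ^ j⌋.toNat % 2

/-- The `k`-th (dyadic) Walsh function. -/
def walsh (k : ℕ) (x : ℝ) : ℝ :=
  (-1 : ℝ) ^ (∑ j ∈ Finset.range k, if k.testBit j then bdigit x (j + 1) else 0)

/-- The multi-dimensional Walsh function. -/
def walshV {s : ℕ} (k : Fin s → ℕ) (x : Fin s → ℝ) : ℝ := ∏ i, walsh (k i) (x i)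

/-- The half-open unit cube `[0,1)^s`. -/
def unitCube (s : ℕ) : Set (Fin s → ℝ) := Set.univ.pi fun _ => Set.Ico (0 : ℝ) 1

/-- The closed unit cube `[0,1]^s`. -/
def closedCube (s : ℕ) : Set (Fin s → ℝ) := Set.univ.pi fun _ => Set.Icc (0 : ℝ) 1

/-- The `k`-th Walsh coefficient of `f`. -/
def walshCoeff {s : ℕ} (f : (Fin s → ℝ) → ℝ) (k : Fin s → ℕ) : ℝ :=
  ∫ x in unitCube s, f x * walshV k x

/-- `z ⊕ 2^{-n}` : flipping the `n`-th binary digit of `z`. -/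
def oplus (z : ℝ) (n : ℕ) : ℝ := z + (-1) ^ bdigit z n * ((2 : ℝ) ^ n)⁻¹

/-- The dyadic difference `∂_{i,n}`. -/
def dyadicDiff {s : ℕ} (i : Fin s) (n : ℕ) (g : (Fin s → ℝ) → ℝ) (x : Fin s → ℝ) : ℝ :=
  2 ^ n * (g (Function.update x i (oplus (x i) n)) - g x)

/-- The function `χ_n`. -/
def chi (n : ℕ) (x y : ℝ) : ℝ :=
  if min x (oplus x n) ≤ y ∧ y ≤ max x (oplus x n) then 2 ^ n else 0

/-- The exponents in the binary expansion of `k`, in decreasing order. -/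
def bitsDesc (k : ℕ) : List ℕ := ((List.range k).filter fun j => k.testBit j).reverse

/-- The number `N` of nonzero binary digits of `k`. -/
def numBits (k : ℕ) : ℕ := (bitsDesc k).length

/-- The weight `μ'_u(k) = ∑_{j=1}^{min(u,N)} (a_j + 2)` for scalar `k`. -/
def muW (u k : ℕ) : ℕ := (((bitsDesc k).take u).map (· + 2)).sum

/-- The weight `μ'_u(k)` for vectors. -/
def muWV {s : ℕ} (u k : Fin s → ℕ) : ℕ := ∑ i, muW (u i) (k i)

/-- `k_{≤}^{u}` : the `u` most significant binary digits of `k`. -/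
def kLe (u k : ℕ) : ℕ := (((bitsDesc k).take u).map (2 ^ ·)).sum

/-- `k_{>}^{u}` : the remaining binary digits of `k`. -/
def kGt (u k : ℕ) : ℕ := (((bitsDesc k).drop u).map (2 ^ ·)).sum

/-- The functions `W(k)`, defined inductively by stripping the least significant
binary digit of `k` (whose exponent is the 2-adic valuation of `k`). -/
def Wfun : ℕ → ℝ → ℝ
  | 0 => fun _ => 1
  | (k + 1) => fun y =>
      ∫ x in Set.Ico (0 : ℝ) 1,
        chi ((k + 1).factorization 2 + 1) x y *
          Wfun ((k + 1) - 2 ^ ((k + 1).factorization 2)) x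
  decreasing_by exact Nat.sub_lt (Nat.succ_pos k) (Nat.two_pow_pos _)

/-- Composition of the dyadic differences `∂_{i,a+1}` for `a` running over a list. -/
def dCompCoord {s : ℕ} (i : Fin s) (L : List ℕ) (g : (Fin s → ℝ) → ℝ) : (Fin s → ℝ) → ℝ :=
  L.foldr (fun a h => dyadicDiff i (a + 1) h) g

/-- The operator `d_{k_u}` : composition over all coordinates `i` of the dyadic
differences `∂_{i,a_{i,j}+1}`, `1 ≤ j ≤ min(u_i, N_i)`. -/
def dComp {s : ℕ} (u k : Fin s → ℕ) (f : (Fin s → ℝ) → ℝ) : (Fin s → ℝ) → ℝ :=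
  (List.finRange s).foldr (fun i g => dCompCoord i ((bitsDesc (k i)).take (u i)) g) f

/-- The multi-index `ν` increased by one in coordinate `i`. -/
def addE {s : ℕ} (i : Fin s) (ν : Fin s → ℕ) : Fin s → ℕ := Function.update ν i (ν i + 1)

/-- `D` is a family of mixed partial derivatives of `f`, of orders up to `u_i` in
the variable `x_i`, each continuous on the closed cube `[0,1]^s`. -/
def HasMixedDerivs {s : ℕ} (u : Fin s → ℕ) (f : (Fin s → ℝ) → ℝ)
    (D : (Fin s → ℕ) → (Fin s → ℝ) → ℝ) : Prop :=
  D (fun _ => 0) = f ∧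
    (∀ ν : Fin s → ℕ, (∀ j, ν j ≤ u j) → ContinuousOn (D ν) (closedCube s)) ∧
    ∀ (ν : Fin s → ℕ) (i : Fin s), (∀ j, addE i ν j ≤ u j) →
      ∀ x ∈ closedCube s,
        HasDerivWithinAt (fun t => D ν (Function.update x i t)) (D (addE i ν) x)
          (Set.Icc 0 1) (x i)

/-- `∫_{[0,1)^{s-|v|}} F dx_{S∖v}` : the inner integral over the coordinates outside `v`
(as a function of the coordinates in `v`). -/
def projInt {s : ℕ} (v : Finset (Fin s)) (F : (Fin s → ℝ) → ℝ) (x : Fin s → ℝ) : ℝ :=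
  ∫ y in unitCube s, F fun i => if i ∈ v then x i else y i

/-- The mixed norm `‖F^{(·)}‖_p` : the `L^p` norm (over the coordinates in `v`) of the
integral of `F` over the coordinates outside `v`. -/
def mixedNorm {s : ℕ} (p : ℝ≥0∞) (v : Finset (Fin s)) (F : (Fin s → ℝ) → ℝ) : ℝ≥0∞ :=
  eLpNorm (projInt v F) p (volume.restrict (unitCube s))

/-- The `ℓ^q` norm of a finite family in `ℝ≥0∞`, with the usual modification at `q = ∞`. -/
def lqNorm {ι : Type*} [Fintype ι] (q : ℝ≥0∞) (a : ι → ℝ≥0∞) : ℝ≥0∞ :=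
  if q = ∞ then ⨆ i, a i else (∑ i, a i ^ q.toReal) ^ q.toReal⁻¹

/-- The `h`-th point of the digital net generated by the matrices `C i`. -/
def netPoint {s m n : ℕ} (C : Fin s → Matrix (Fin n) (Fin m) (ZMod 2)) (h : Fin (2 ^ m)) :
    Fin s → ℝ :=
  fun i => ∑ j : Fin n,
    (((∑ l : Fin m, (if (h : ℕ).testBit (l : ℕ) then (1 : ZMod 2) else 0) * C i j l).val : ℝ) *
      ((2 : ℝ) ^ ((j : ℕ) + 1))⁻¹)

/-- Membership of `k ∈ ℕ₀^s` in the dual net `P^⊥`. -/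
def inDual {s m n : ℕ} (C : Fin s → Matrix (Fin n) (Fin m) (ZMod 2)) (k : Fin s → ℕ) : Prop :=
  ∀ l : Fin m, ∑ i, ∑ j : Fin n, C i j l * (if (k i).testBit (j : ℕ) then (1 : ZMod 2) else 0) = 0

open Classical in
/-- `∑_{k_v ∈ P_v^⊥} 2^{-μ'_α(k_v)}`, encoded as a sum over all `k ∈ ℕ₀^s`
with support exactly `v` lying in the dual net. -/
def dualSum {s m n : ℕ} (α : ℕ) (C : Fin s → Matrix (Fin n) (Fin m) (ZMod 2))
    (v : Finset (Fin s)) : ℝ≥0∞ :=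
  ∑' k : Fin s → ℕ,
    if (∀ i, i ∈ v ↔ k i ≠ 0) ∧ inDual C k
    then (2 : ℝ≥0∞) ^ (-(muWV (fun _ => α) k : ℝ)) else 0


theorem bdigit_eq_natFloor (x : ℝ) (j : ℕ) : bdigit x j = ⌊x * 2 ^ j⌋₊ % 2 := by
  rw [bdigit, Int.floor_toNat]

theorem oplus_of_bdigit_eq_zero {x : ℝ} {n : ℕ} (h : bdigit x n = 0) :
    oplus x n = x + ((2 : ℝ) ^ n)⁻¹ := by
  simp [oplus, h]

theorem oplus_of_bdigit_eq_one {x : ℝ} {n : ℕ} (h : bdigit x n = 1) :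
    oplus x n = x - ((2 : ℝ) ^ n)⁻¹ := by
  simp [oplus, h, sub_eq_add_neg]

theorem bdigit_eq_zero_or_one (x : ℝ) (n : ℕ) : bdigit x n = 0 ∨ bdigit x n = 1 :=
  Nat.mod_two_eq_zero_or_one _

theorem measurable_bdigit (n : ℕ) : Measurable fun x => bdigit x n := by
  simp only [bdigit_eq_natFloor]
  exact (measurable_from_top (f := fun m : ℕ => m % 2)).comp
    (Nat.measurable_floor.comp (measurable_id.mul_const _))

theorem measurable_walsh (k : ℕ) : Measurable (walsh k) := by
  refine (measurable_from_top (f := fun m : ℕ => (-1 : ℝ) ^ m)).comp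
    (Finset.measurable_sum _ fun j _ => ?_)
  split_ifs
  exacts [measurable_bdigit _, measurable_const]

theorem measurable_oplus (n : ℕ) : Measurable fun x => oplus x n :=
  measurable_id.add <| (((measurable_from_top (f := fun m : ℕ => (-1 : ℝ) ^ m)).comp
    (measurable_bdigit n)).mul_const _)

theorem natFloor_add_inv_two_pow {x : ℝ} (hx : 0 ≤ x) (n : ℕ) :
    ⌊(x + ((2 : ℝ) ^ n)⁻¹) * 2 ^ n⌋₊ = ⌊x * 2 ^ n⌋₊ + 1 := by
  rw [add_mul, inv_mul_cancel₀ (by positivity), Nat.floor_add_one (by positivity)]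

/-- The digits of `x + 2^{-n}` when the `n`-th digit of `x` vanishes. -/
theorem bdigit_add_inv_two_pow {x : ℝ} (hx : 0 ≤ x) {n : ℕ} (h : bdigit x n = 0) (j : ℕ) :
    bdigit (x + ((2 : ℝ) ^ n)⁻¹) j = if j = n then 1 else bdigit x j := by
  rw [bdigit_eq_natFloor] at h
  simp only [bdigit_eq_natFloor]
  rcases lt_trichotomy j n with hj | rfl | hj
  · obtain ⟨d, rfl⟩ := Nat.exists_eq_add_of_lt hj
    have key (y : ℝ) : ⌊y * 2 ^ j⌋₊ = ⌊y * 2 ^ (j + d + 1)⌋₊ / 2 ^ (d + 1) := by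
      rw [← Nat.floor_div_natCast]
      congr 1
      push_cast
      field_simp
      ring
    rw [if_neg hj.ne, key, natFloor_add_inv_two_pow hx, key x, pow_succ' 2 d,
      ← Nat.div_div_eq_div_mul, ← Nat.div_div_eq_div_mul]
    congr 2
    lia
  · rw [if_pos rfl, natFloor_add_inv_two_pow hx]
    lia
  · obtain ⟨d, rfl⟩ := Nat.exists_eq_add_of_lt hj
    have key : (x + ((2 : ℝ) ^ n)⁻¹) * 2 ^ (n + d + 1) =
        x * 2 ^ (n + d + 1) + ((2 * 2 ^ d : ℕ) : ℝ) := by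
      push_cast
      field_simp
      ring
    rw [if_neg hj.ne', key, Nat.floor_add_natCast (by positivity), Nat.add_mul_mod_self_left]

theorem inv_two_pow_le_of_bdigit_eq_one {x : ℝ} {n : ℕ} (h : bdigit x n = 1) :
    ((2 : ℝ) ^ n)⁻¹ ≤ x := by
  rw [bdigit_eq_natFloor] at h
  have h1 : 1 ≤ ⌊x * 2 ^ n⌋₊ := by lia
  rw [Nat.one_le_floor_iff] at h1
  rwa [inv_le_iff_one_le_mul₀ (by positivity)]

/-- The `n`-th digit of `x - 2^{-n}` vanishes when the `n`-th digit of `x` is one. -/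
theorem bdigit_sub_inv_two_pow_self {x : ℝ} {n : ℕ} (h : bdigit x n = 1) :
    bdigit (x - ((2 : ℝ) ^ n)⁻¹) n = 0 := by
  have hx := inv_two_pow_le_of_bdigit_eq_one h
  have := natFloor_add_inv_two_pow (sub_nonneg.2 hx) n
  rw [bdigit_eq_natFloor] at h ⊢
  rw [sub_add_cancel] at this
  lia

theorem bdigit_oplus {x : ℝ} (hx : 0 ≤ x) (n j : ℕ) :
    bdigit (oplus x n) j = if j = n then 1 - bdigit x n else bdigit x j := by
  rcases bdigit_eq_zero_or_one x n with h | h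
  · rw [oplus_of_bdigit_eq_zero h, bdigit_add_inv_two_pow hx h, h]
  · have h0 := bdigit_sub_inv_two_pow_self h
    rw [oplus_of_bdigit_eq_one h, h]
    split_ifs with hj
    · rw [hj, h0]
    · have := bdigit_add_inv_two_pow
        (sub_nonneg.2 (inv_two_pow_le_of_bdigit_eq_one h)) h0 j
      rw [if_neg hj, sub_add_cancel] at this
      exact this.symm

/-- Flipping a binary digit that belongs to `k` changes the sign of the `k`-th Walsh function. -/
theorem walsh_oplus {k a : ℕ} (ha : k.testBit a) {x : ℝ} (hx : 0 ≤ x) :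
    walsh k (oplus x (a + 1)) = -walsh k x := by
  have hak : a ∈ Finset.range k :=
    Finset.mem_range.2 (a.lt_two_pow_self.trans_le (Nat.ge_two_pow_of_testBit ha))
  simp only [walsh, ← Finset.prod_pow_eq_pow_sum]
  rw [← Finset.mul_prod_erase _ _ hak, ← Finset.mul_prod_erase _ _ hak, ← neg_mul]
  congr 1
  · rw [if_pos ha, if_pos ha, bdigit_oplus hx, if_pos rfl]
    rcases bdigit_eq_zero_or_one x (a + 1) with h | h <;> simp [h]
  · refine Finset.prod_congr rfl fun j hj => ?_
    rw [bdigit_oplus hx, if_neg (Nat.succ_ne_succ_iff.2 (Finset.ne_of_mem_erase hj))]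

theorem add_inv_two_pow_lt_one {x : ℝ} (hx : x ∈ Set.Ico (0 : ℝ) 1) {n : ℕ} (hn : n ≠ 0)
    (h : bdigit x n = 0) : x + ((2 : ℝ) ^ n)⁻¹ < 1 := by
  rw [bdigit_eq_natFloor] at h
  have hlt : ⌊x * 2 ^ n⌋₊ < 2 ^ n := by
    rw [Nat.floor_lt (mul_nonneg hx.1 (by positivity))]
    push_cast
    exact mul_lt_of_lt_one_left (by positivity) hx.2
  have heven : 2 ^ n % 2 = 0 := Nat.mod_eq_zero_of_dvd (dvd_pow_self 2 hn)
  have hlt' : ⌊(x + ((2 : ℝ) ^ n)⁻¹) * 2 ^ n⌋₊ < 2 ^ n := by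
    rw [natFloor_add_inv_two_pow hx.1]
    lia
  have hx0 := hx.1
  rw [Nat.floor_lt (by positivity)] at hlt'
  push_cast at hlt'
  exact (mul_lt_iff_lt_one_left (by positivity)).1 hlt'

/-- Flipping the `n`-th binary digit preserves Lebesgue measure on `[0,1)`. -/
theorem measurePreserving_oplus {n : ℕ} (hn : n ≠ 0) :
    MeasurePreserving (fun x => oplus x n) (volume.restrict (Set.Ico (0 : ℝ) 1))
      (volume.restrict (Set.Ico (0 : ℝ) 1)) := by
  refine ⟨measurable_oplus n, Measure.ext fun A hA => ?_⟩
  set c : ℝ := ((2 : ℝ) ^ n)⁻¹ with hc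
  have hc0 : 0 < c := by positivity
  set E : Set ℝ := {x | bdigit x n = 0} with hE
  have hEm : MeasurableSet E := measurable_bdigit n (measurableSet_singleton 0)
  rw [Measure.map_apply (measurable_oplus n) hA,
    Measure.restrict_apply (measurable_oplus n hA), Measure.restrict_apply hA,
    ← measure_inter_add_sdiff _ hEm, ← measure_inter_add_sdiff (A ∩ _) hEm, add_comm]
  have h1 : ((fun x => oplus x n) ⁻¹' A ∩ Set.Ico 0 1) ∩ E =
      (fun x => x + c) ⁻¹' ((A ∩ Set.Ico 0 1) \ E) := by
    ext x
    simp only [Set.mem_inter_iff, Set.mem_preimage, Set.mem_sdiff, hE, Set.mem_ofPred_eq]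
    constructor
    · rintro ⟨⟨hxA, hx⟩, hd⟩
      rw [oplus_of_bdigit_eq_zero hd] at hxA
      refine ⟨⟨hxA, by linarith [hx.1], add_inv_two_pow_lt_one hx hn hd⟩, ?_⟩
      rw [bdigit_add_inv_two_pow hx.1 hd, if_pos rfl]
      exact one_ne_zero
    · rintro ⟨⟨hxA, hx⟩, hd⟩
      have hd' := (bdigit_eq_zero_or_one (x + c) n).resolve_left hd
      have h0 := bdigit_sub_inv_two_pow_self hd'
      have hle := inv_two_pow_le_of_bdigit_eq_one hd'
      rw [← hc, add_sub_cancel_right] at h0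
      rw [oplus_of_bdigit_eq_zero h0]
      exact ⟨⟨hxA, by linarith, by linarith [hx.2]⟩, h0⟩
  have h2 : ((fun x => oplus x n) ⁻¹' A ∩ Set.Ico 0 1) \ E =
      (fun x => x - c) ⁻¹' ((A ∩ Set.Ico 0 1) ∩ E) := by
    ext x
    simp only [Set.mem_inter_iff, Set.mem_preimage, Set.mem_sdiff, hE, Set.mem_ofPred_eq]
    constructor
    · rintro ⟨⟨hxA, hx⟩, hd⟩
      have hd' := (bdigit_eq_zero_or_one x n).resolve_left hd
      have hle := inv_two_pow_le_of_bdigit_eq_one hd'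
      rw [oplus_of_bdigit_eq_one hd'] at hxA
      exact ⟨⟨hxA, by linarith, by linarith [hx.2]⟩, bdigit_sub_inv_two_pow_self hd'⟩
    · rintro ⟨⟨hxA, hx⟩, hd⟩
      have h1 := bdigit_add_inv_two_pow hx.1 hd n
      have hlt := add_inv_two_pow_lt_one hx hn hd
      rw [← hc, sub_add_cancel] at h1 hlt
      rw [if_pos rfl] at h1
      rw [oplus_of_bdigit_eq_one h1]
      exact ⟨⟨hxA, by linarith [hx.1], hlt⟩, by rw [h1]; exact one_ne_zero⟩
  rw [h1, h2, measure_preimage_add_right]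
  simp only [sub_eq_add_neg, measure_preimage_add_right]

theorem measurePreserving_update_oplus {s n : ℕ} (hn : n ≠ 0) (i : Fin s) :
    MeasurePreserving (fun x : Fin s → ℝ => Function.update x i (oplus (x i) n))
      (volume.restrict (unitCube s)) (volume.restrict (unitCube s)) := by
  rw [unitCube, volume_pi, Measure.restrict_pi_pi]
  have h := measurePreserving_pi (fun _ : Fin s => volume.restrict (Set.Ico (0 : ℝ) 1))
    (fun _ : Fin s => volume.restrict (Set.Ico (0 : ℝ) 1))
    (f := fun j x => if j = i then oplus x n else x) fun j => by
      by_cases hj : j = i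
      · simpa only [hj, if_true] using measurePreserving_oplus hn
      · simpa only [hj, if_false] using! MeasurePreserving.id (volume.restrict (Set.Ico (0 : ℝ) 1))
  have heq : (fun x : Fin s → ℝ => Function.update x i (oplus (x i) n)) =
      fun x j => if j = i then oplus (x j) n else x j := by
    ext x j
    by_cases hj : j = i
    · subst hj
      simp
    · simp [hj]
  rw [heq]
  exact h

theorem measurable_walshV {s : ℕ} (k : Fin s → ℕ) : Measurable (walshV k) :=
  Finset.measurable_prod _ fun i _ => (measurable_walsh (k i)).comp (measurable_pi_apply i)

theorem norm_walshV {s : ℕ} (k : Fin s → ℕ) (x : Fin s → ℝ) : ‖walshV k x‖ = 1 := by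
  simp [walshV, walsh]

theorem walshV_update_oplus {s : ℕ} {k : Fin s → ℕ} {i : Fin s} {a : ℕ}
    (ha : (k i).testBit a) {x : Fin s → ℝ} (hx : 0 ≤ x i) :
    walshV k (Function.update x i (oplus (x i) (a + 1))) = -walshV k x := by
  simp only [walshV]
  rw [← Finset.mul_prod_erase _ _ (Finset.mem_univ i),
    ← Finset.mul_prod_erase univ (fun j => walsh (k j) (x j)) (Finset.mem_univ i), ← neg_mul,
    Function.update_self, walsh_oplus ha hx]
  congr 1
  refine Finset.prod_congr rfl fun j hj => ?_
  rw [Function.update_of_ne (Finset.ne_of_mem_erase hj)]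

theorem MeasureTheory.Integrable.mul_walshV {s : ℕ} {μ : Measure (Fin s → ℝ)}
    {g : (Fin s → ℝ) → ℝ} (hg : Integrable g μ) (k : Fin s → ℕ) :
    Integrable (fun x => g x * walshV k x) μ :=
  hg.mul_bdd (c := 1) (measurable_walshV k).aestronglyMeasurable
    (Filter.Eventually.of_forall fun x => (norm_walshV k x).le)

/-- formula (10): for `f ∈ L¹([0,1)^s)` and any set bit `a = a_{i,j}`
of `k_i`, `∂_{i,a+1}(f) ∈ L¹([0,1)^s)` and
`f̂(k) = (-1) ⋅ 2^{-a-2} ⋅ (∂_{i,a+1}(f))^̂(k)`. -/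
theorem stmt4 {s : ℕ} (hs : 1 ≤ s) (f : (Fin s → ℝ) → ℝ)
    (hf : IntegrableOn f (unitCube s))
    (k : Fin s → ℕ) (i : Fin s) (hki : k i ≠ 0) (a : ℕ) (ha : (k i).testBit a) :
    IntegrableOn (dyadicDiff i (a + 1) f) (unitCube s) ∧
      walshCoeff f k =
        -(((2 : ℝ) ^ (a + 2))⁻¹) * walshCoeff (dyadicDiff i (a + 1) f) k := by
  have hT := measurePreserving_update_oplus a.succ_ne_zero i
  have hfT : IntegrableOn (fun x => f (Function.update x i (oplus (x i) (a + 1))))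
      (unitCube s) := hT.integrable_comp_of_integrable hf
  refine ⟨(hfT.sub hf).const_mul _, ?_⟩
  have hcube : MeasurableSet (unitCube s) :=
    MeasurableSet.univ_pi fun _ => measurableSet_Ico
  have hflip : walshCoeff (fun x => f (Function.update x i (oplus (x i) (a + 1)))) k =
      -walshCoeff f k := by
    have hfw := (hf.mul_walshV k).aestronglyMeasurable
    rw [← hT.map_eq] at hfw
    have hmap := integral_map hT.measurable.aemeasurable hfw
    rw [hT.map_eq] at hmap
    rw [walshCoeff, walshCoeff, hmap, ← integral_neg]
    refine setIntegral_congr_fun hcube fun x hx => ?_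
    simp only [walshV_update_oplus ha (hx i (Set.mem_univ i)).1, mul_neg, neg_neg]
  have hdiff : walshCoeff (dyadicDiff i (a + 1) f) k = 2 ^ (a + 1) *
      (walshCoeff (fun x => f (Function.update x i (oplus (x i) (a + 1)))) k -
        walshCoeff f k) := by
    simp only [walshCoeff, dyadicDiff, mul_assoc, sub_mul]
    rw [integral_const_mul, integral_sub (hfT.mul_walshV k) (hf.mul_walshV k)]
  rw [hdiff, hflip]
  field_simp
  ring
end
end

section
/- Let n ∈ ℕ and let c ∈ ℕ₀ with c < 2^{n−1}. If x ∈ [c·2^{−n+1}, (c+1)·2^{−n+1}) and y ∈ [0,1) \ [c·2^{−n+1}, (c+1)·2^{−n+1}), then χ_n(x,y) = 0. Likewise, if y ∈ [c·2^{−n+1}, (c+1)·2^{−n+1}) and x ∈ [0,1) \ [c·2^{−n+1}, (c+1)·2^{−n+1}), then χ_n(x,y) = 0. -/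
open MeasureTheory Finset
open scoped ENNReal

noncomputable section

/-- Flipping the `n`-th digit preserves the dyadic intervals of length `2^{1-n}`. -/
theorem oplus_mem_Ico {n c : ℕ} {x : ℝ}
    (hx : x ∈ Set.Ico ((c : ℝ) * (2 : ℝ) ^ (1 - (n : ℤ))) (((c : ℝ) + 1) * (2 : ℝ) ^ (1 - (n : ℤ)))) :
    oplus x n ∈
      Set.Ico ((c : ℝ) * (2 : ℝ) ^ (1 - (n : ℤ))) (((c : ℝ) + 1) * (2 : ℝ) ^ (1 - (n : ℤ))) := by
  have hw : (2 : ℝ) ^ (1 - (n : ℤ)) = 2 * ((2 : ℝ) ^ n)⁻¹ := by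
    rw [zpow_sub₀ two_ne_zero, zpow_one, zpow_natCast, div_eq_mul_inv]
  rw [hw] at hx ⊢
  obtain ⟨h₁, h₂⟩ := hx
  have hp : (0 : ℝ) < 2 ^ n := by positivity
  have hq : (0 : ℝ) < ((2 : ℝ) ^ n)⁻¹ := inv_pos.mpr hp
  have hx' : x = x * 2 ^ n * ((2 : ℝ) ^ n)⁻¹ := by field_simp
  rcases lt_or_ge (x * 2 ^ n) (2 * c + 1) with h | h
  · have hlow : (2 * c : ℝ) ≤ x * 2 ^ n := by
      by_contra! hlt
      nlinarith
    have hf : ⌊x * 2 ^ n⌋ = ((2 * c : ℕ) : ℤ) := by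
      rw [Int.floor_eq_iff]
      push_cast
      exact ⟨hlow, h⟩
    have hd : bdigit x n = 0 := by
      rw [bdigit, hf, Int.toNat_natCast]
      omega
    rw [oplus, hd]
    constructor <;> nlinarith
  · have hhigh : x * 2 ^ n < 2 * c + 2 := by
      by_contra! hle
      nlinarith
    have hf : ⌊x * 2 ^ n⌋ = ((2 * c + 1 : ℕ) : ℤ) := by
      rw [Int.floor_eq_iff]
      push_cast
      exact ⟨h, by linarith⟩
    have hd : bdigit x n = 1 := by
      rw [bdigit, hf, Int.toNat_natCast]
      omega
    rw [oplus, hd]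
    constructor <;> nlinarith

/-- `χ_n(x, ·)` is supported in the dyadic interval of length `2^{1-n}` containing `x`. -/
theorem chi_eq_zero_of_notMem {n c : ℕ} {x y : ℝ}
    (hx : x ∈ Set.Ico ((c : ℝ) * (2 : ℝ) ^ (1 - (n : ℤ))) (((c : ℝ) + 1) * (2 : ℝ) ^ (1 - (n : ℤ))))
    (hy : y ∉ Set.Ico ((c : ℝ) * (2 : ℝ) ^ (1 - (n : ℤ)))
      (((c : ℝ) + 1) * (2 : ℝ) ^ (1 - (n : ℤ)))) :
    chi n x y = 0 := by
  have ho := oplus_mem_Ico hx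
  refine if_neg fun h => hy ⟨?_, ?_⟩
  · exact (le_min hx.1 ho.1).trans h.1
  · exact h.2.trans_lt (max_lt hx.2 ho.2)

/-- Lemma `period_chi`, item 2: `χ_n(x,y) = 0` whenever exactly one of
`x, y` lies in `[c⋅2^{-n+1}, (c+1)⋅2^{-n+1})`. -/
theorem stmt10 (n : ℕ) (hn : 1 ≤ n) (c : ℕ) (hc : c < 2 ^ (n - 1)) (x y : ℝ) :
    (x ∈ Set.Ico ((c : ℝ) * (2 : ℝ) ^ (1 - (n : ℤ))) (((c : ℝ) + 1) * (2 : ℝ) ^ (1 - (n : ℤ))) →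
      y ∈ Set.Ico (0 : ℝ) 1 \
        Set.Ico ((c : ℝ) * (2 : ℝ) ^ (1 - (n : ℤ))) (((c : ℝ) + 1) * (2 : ℝ) ^ (1 - (n : ℤ))) →
      chi n x y = 0) ∧
    (y ∈ Set.Ico ((c : ℝ) * (2 : ℝ) ^ (1 - (n : ℤ))) (((c : ℝ) + 1) * (2 : ℝ) ^ (1 - (n : ℤ))) →
      x ∈ Set.Ico (0 : ℝ) 1 \
        Set.Ico ((c : ℝ) * (2 : ℝ) ^ (1 - (n : ℤ))) (((c : ℝ) + 1) * (2 : ℝ) ^ (1 - (n : ℤ))) →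
      chi n x y = 0) := by
  refine ⟨fun hx hy => chi_eq_zero_of_notMem hx hy.2, fun hy hx => ?_⟩
  have hw : (0 : ℝ) < (2 : ℝ) ^ (1 - (n : ℤ)) := by positivity
  have hfloor : ∀ {d : ℕ} {z : ℝ}, 0 ≤ z →
      (z ∈ Set.Ico ((d : ℝ) * (2 : ℝ) ^ (1 - (n : ℤ))) (((d : ℝ) + 1) * (2 : ℝ) ^ (1 - (n : ℤ))) ↔
        ⌊z / (2 : ℝ) ^ (1 - (n : ℤ))⌋₊ = d) := by
    intro d z hz
    rw [Nat.floor_eq_iff (div_nonneg hz hw.le), le_div_iff₀ hw, div_lt_iff₀ hw, Set.mem_Ico]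
  have hy₀ : 0 ≤ y := (by positivity : (0 : ℝ) ≤ c * (2 : ℝ) ^ (1 - (n : ℤ))).trans hy.1
  refine chi_eq_zero_of_notMem ((hfloor hx.1.1).2 rfl) fun hy' => hx.2 ?_
  rw [hfloor hx.1.1, ← (hfloor hy₀).1 hy', (hfloor hy₀).1 hy]

end
end
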